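/- Let n ∈ S with n ≥ 1, set c_n := (1000√n)^{-1}, and let Q_n := {(x,y) ∈ ℝ² : |x| ≤ c_n and |y| ≤ c_n}. If z ∈ Q_n is such that r_n(z) = 1 or r_n(z) = −1, then z = 0. -/

import Mathlib

noncomputable section

/-- The set of lattice points `λ ∈ ℤ²` with `‖λ‖² = n`. -/
def Lam (n : ℕ) : Finset (ℤ × ℤ) :=
  (Finset.Icc (-(n : ℤ), -(n : ℤ)) ((n : ℤ), (n : ℤ))).filter
    fun l => l.1 ^ 2 + l.2 ^ 2 = (n : ℤ)

/-- `𝒩_n`, the number of lattice points on the circle of radius `√n`. -/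
def Nn (n : ℕ) : ℕ := (Lam n).card

/-- `n ∈ S`: `n ≥ 1` is a sum of two integer squares. -/
def inS (n : ℕ) : Prop := 1 ≤ n ∧ ∃ a b : ℤ, a ^ 2 + b ^ 2 = (n : ℤ)

/-- The covariance function `r_n(z) = 𝒩_n⁻¹ Σ_{λ∈Λ_n} cos(2π⟨λ,z⟩)`. -/
def rCov (n : ℕ) (z : ℝ × ℝ) : ℝ :=
  (Nn n : ℝ)⁻¹ * ∑ l ∈ Lam n, Real.cos (2 * Real.pi * ((l.1 : ℝ) * z.1 + (l.2 : ℝ) * z.2))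

theorem mem_Lam {n : ℕ} {l : ℤ × ℤ} : l ∈ Lam n ↔ l.1 ^ 2 + l.2 ^ 2 = (n : ℤ) := by
  simp only [Lam, Finset.mem_filter, Finset.mem_Icc, Prod.le_def, and_iff_right_iff_imp]
  intro h
  have h1 : l.1 ^ 2 ≤ (n : ℤ) ^ 2 := by nlinarith [sq_nonneg l.2, sq_nonneg l.1]
  have h2 : l.2 ^ 2 ≤ (n : ℤ) ^ 2 := by nlinarith [sq_nonneg l.2, sq_nonneg l.1]
  have hn : (0 : ℤ) ≤ n := Int.natCast_nonneg n
  have := abs_le_of_sq_le_sq' h1 hn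
  have := abs_le_of_sq_le_sq' h2 hn
  tauto

theorem abs_inner_le_of_mem_Lam {n : ℕ} (hn : 1 ≤ n) {z : ℝ × ℝ}
    (hz1 : |z.1| ≤ (1000 * Real.sqrt n)⁻¹) (hz2 : |z.2| ≤ (1000 * Real.sqrt n)⁻¹)
    {l : ℤ × ℤ} (hl : l ∈ Lam n) : |(l.1 : ℝ) * z.1 + (l.2 : ℝ) * z.2| ≤ 1 / 500 := by
  have hs : 0 < Real.sqrt n := Real.sqrt_pos.2 (by exact_mod_cast hn)
  have e : (l.1 : ℝ) ^ 2 + (l.2 : ℝ) ^ 2 = n := by exact_mod_cast mem_Lam.1 hl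
  have h1 : |(l.1 : ℝ)| ≤ Real.sqrt n := Real.abs_le_sqrt (by nlinarith [sq_nonneg (l.2 : ℝ)])
  have h2 : |(l.2 : ℝ)| ≤ Real.sqrt n := Real.abs_le_sqrt (by nlinarith [sq_nonneg (l.1 : ℝ)])
  calc |(l.1 : ℝ) * z.1 + (l.2 : ℝ) * z.2|
      ≤ |(l.1 : ℝ)| * |z.1| + |(l.2 : ℝ)| * |z.2| := by
        rw [← abs_mul, ← abs_mul]; exact abs_add_le _ _
    _ ≤ Real.sqrt n * (1000 * Real.sqrt n)⁻¹ + Real.sqrt n * (1000 * Real.sqrt n)⁻¹ := by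
        gcongr
    _ = 1 / 500 := by field_simp; norm_num

/-- Let `n ∈ S`, `c_n = (1000√n)⁻¹` and
`Q_n = {(x,y) : |x| ≤ c_n, |y| ≤ c_n}`. If `z ∈ Q_n` satisfies `r_n(z) = ±1`, then `z = 0`. -/
theorem rCov_extreme_only_at_zero (n : ℕ) (hn : inS n) (z : ℝ × ℝ)
    (hz1 : |z.1| ≤ (1000 * Real.sqrt n)⁻¹) (hz2 : |z.2| ≤ (1000 * Real.sqrt n)⁻¹)
    (hr : rCov n z = 1 ∨ rCov n z = -1) :
    z = 0 := by
  obtain ⟨hn1, a, b, hab⟩ := hn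
  have hm1 : (a, b) ∈ Lam n := mem_Lam.2 hab
  have hm2 : (-b, a) ∈ Lam n := mem_Lam.2 (by simp only; linarith [neg_sq b])
  have hN : (0 : ℝ) < Nn n := by exact_mod_cast Finset.card_pos.2 ⟨_, hm1⟩
  have hθ : ∀ l ∈ Lam n,
      |2 * Real.pi * ((l.1 : ℝ) * z.1 + (l.2 : ℝ) * z.2)| < Real.pi / 2 := fun l hl => by
    rw [abs_mul, abs_of_pos Real.two_pi_pos]
    nlinarith [abs_inner_le_of_mem_Lam hn1 hz1 hz2 hl, Real.pi_pos]
  have hpos : 0 < rCov n z := by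
    refine mul_pos (inv_pos.2 hN) (Finset.sum_pos (fun l hl => ?_) ⟨_, hm1⟩)
    exact Real.cos_pos_of_mem_Ioo (abs_lt.1 (hθ l hl) |>.imp (by intro h; linarith) id)
  have hr1 : rCov n z = 1 := hr.resolve_right (by linarith)
  have hsum : ∑ l ∈ Lam n,
      Real.cos (2 * Real.pi * ((l.1 : ℝ) * z.1 + (l.2 : ℝ) * z.2)) = ∑ l ∈ Lam n, (1 : ℝ) := by
    rw [rCov, inv_mul_eq_one₀ hN.ne'] at hr1
    rw [← hr1, Nn]
    simp
  have hcos := (Finset.sum_eq_sum_iff_of_le fun l _ => Real.cos_le_one _).1 hsum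
  have hzero : ∀ l ∈ Lam n, (l.1 : ℝ) * z.1 + (l.2 : ℝ) * z.2 = 0 := fun l hl => by
    obtain ⟨h1, h2⟩ := abs_lt.1 (hθ l hl)
    have := (Real.cos_eq_one_iff_of_lt_of_lt (by linarith [Real.pi_pos])
      (by linarith [Real.pi_pos])).1 (hcos l hl)
    exact (mul_eq_zero.1 this).resolve_left Real.two_pi_pos.ne'
  have e1 := hzero _ hm1
  have e2 := hzero _ hm2
  push_cast at e1 e2
  have hn0 : (n : ℝ) ≠ 0 := by positivity
  have hab' : (a : ℝ) ^ 2 + (b : ℝ) ^ 2 = n := by exact_mod_cast hab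
  have x0 : (n : ℝ) * z.1 = 0 := by rw [← hab']; linear_combination a * e1 - b * e2
  have y0 : (n : ℝ) * z.2 = 0 := by rw [← hab']; linear_combination b * e1 + a * e2
  exact Prod.ext ((mul_eq_zero.1 x0).resolve_left hn0) ((mul_eq_zero.1 y0).resolve_left hn0)

end
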